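/- arXiv:2104.00420 — 6 statements merged into one kernel-verified Lean document; each statement's English description precedes it below -/
import Mathlib

section
/- Let ρ be a Borel probability measure on 𝕊^{d−1}, let 𝓔 : 𝕊^{d−1} → ℝ be bounded Borel and α > 0. Then ∫_{𝕊^{d−1}} |v − v_α(ρ)|² dρ(v) ≤ 4 (exp(−α𝓔̲)/‖ω_α‖_{L¹(ρ)}) V(ρ) ≤ 4 C_{α,𝓔} V(ρ). -/
open MeasureTheory Real RealInnerProductSpace

noncomputable section

/-- The unit sphere `𝕊^{d-1}` in `ℝ^d`. -/
def sph (d : ℕ) : Set (EuclideanSpace ℝ (Fin d)) := Metric.sphere 0 1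

/-- The mean `E(ρ) = ∫ v dρ(v)`. -/
def meanM {d : ℕ} (ρ : Measure (EuclideanSpace ℝ (Fin d))) : EuclideanSpace ℝ (Fin d) :=
  ∫ v, v ∂ρ

/-- The variance `V(ρ) = (1/2) ∫ |v - E(ρ)|² dρ(v)`. -/
def varM {d : ℕ} (ρ : Measure (EuclideanSpace ℝ (Fin d))) : ℝ :=
  (1/2) * ∫ v, ‖v - meanM ρ‖ ^ 2 ∂ρ

/-- `‖ω_α‖_{L¹(ρ)} = ∫ exp(-α 𝓔(v)) dρ(v)`. -/
def wNorm {d : ℕ} (𝓔 : EuclideanSpace ℝ (Fin d) → ℝ) (α : ℝ)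
    (ρ : Measure (EuclideanSpace ℝ (Fin d))) : ℝ :=
  ∫ v, Real.exp (-α * 𝓔 v) ∂ρ

/-- The weighted mean `v_α(ρ) = (∫ v exp(-α 𝓔(v)) dρ(v)) / ‖ω_α‖_{L¹(ρ)}`. -/
def vAlpha {d : ℕ} (𝓔 : EuclideanSpace ℝ (Fin d) → ℝ) (α : ℝ)
    (ρ : Measure (EuclideanSpace ℝ (Fin d))) : EuclideanSpace ℝ (Fin d) :=
  (wNorm 𝓔 α ρ)⁻¹ • ∫ v, Real.exp (-α * 𝓔 v) • v ∂ρ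

/-- `𝓔̲ = inf_{𝕊^{d-1}} 𝓔`. -/
def eInf {d : ℕ} (𝓔 : EuclideanSpace ℝ (Fin d) → ℝ) : ℝ := sInf (𝓔 '' sph d)

/-- `𝓔̄ = sup_{𝕊^{d-1}} 𝓔`. -/
def eSup {d : ℕ} (𝓔 : EuclideanSpace ℝ (Fin d) → ℝ) : ℝ := sSup (𝓔 '' sph d)

/-- `C_{α,𝓔} = exp(α(𝓔̄ - 𝓔̲))`. -/
def Cae {d : ℕ} (𝓔 : EuclideanSpace ℝ (Fin d) → ℝ) (α : ℝ) : ℝ :=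
  Real.exp (α * (eSup 𝓔 - eInf 𝓔))

section WeightedMean

variable {E : Type*} [NormedAddCommGroup E] [InnerProductSpace ℝ E] [CompleteSpace E]
  [MeasurableSpace E] {ρ : Measure E}

/-- The second moment about `a` splits into the second moment about the mean and the squared
distance from the mean to `a`. -/
theorem integral_norm_sub_sq_eq_add [IsProbabilityMeasure ρ]
    (hv : Integrable (fun v : E => v) ρ)
    (hsq : Integrable (fun v : E => ‖v - ∫ u, u ∂ρ‖ ^ 2) ρ) (a : E) :
    ∫ v, ‖v - a‖ ^ 2 ∂ρ = (∫ v, ‖v - ∫ u, u ∂ρ‖ ^ 2 ∂ρ) + ‖(∫ u, u ∂ρ) - a‖ ^ 2 := by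
  set m := ∫ u, u ∂ρ with hm
  have hsub : Integrable (fun v : E => v - m) ρ := hv.sub (integrable_const m)
  have hin : Integrable (fun v : E => 2 * ⟪m - a, v - m⟫) ρ :=
    (hsub.const_inner (m - a)).const_mul 2
  have hadd : Integrable (fun v : E => ‖v - m‖ ^ 2 + 2 * ⟪m - a, v - m⟫) ρ := hsq.add hin
  have hzero : ∫ v, 2 * ⟪m - a, v - m⟫ ∂ρ = 0 := by
    rw [integral_const_mul, integral_inner hsub, integral_sub hv (integrable_const m)]
    simp [← hm]
  have hexp : ∀ v : E, ‖v - a‖ ^ 2 = ‖v - m‖ ^ 2 + 2 * ⟪m - a, v - m⟫ + ‖m - a‖ ^ 2 := by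
    intro v
    rw [real_inner_comm, ← norm_add_sq_real, sub_add_sub_cancel]
  rw [integral_congr_ae (Filter.Eventually.of_forall hexp)]
  rw [integral_add hadd (integrable_const _), integral_add hsq hin, hzero]
  simp

/-- Jensen's inequality for the squared distance to `m` and a weighted mean. -/
theorem integral_mul_norm_sub_weighted_mean_sq_le {w : E → ℝ} (hw : Integrable w ρ)
    (hnonneg : ∀ᵐ v ∂ρ, 0 ≤ w v) (hpos : 0 < ∫ v, w v ∂ρ)
    (hwv : Integrable (fun v => w v • v) ρ) (m : E)
    (hsq : Integrable (fun v => w v * ‖v - m‖ ^ 2) ρ) :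
    (∫ v, w v ∂ρ) * ‖m - (∫ v, w v ∂ρ)⁻¹ • ∫ v, w v • v ∂ρ‖ ^ 2
      ≤ ∫ v, w v * ‖v - m‖ ^ 2 ∂ρ := by
  set W := ∫ v, w v ∂ρ with hW
  set a := W⁻¹ • ∫ v, w v • v ∂ρ with ha
  have hWa : ∫ v, w v • v ∂ρ = W • a := by rw [ha, smul_inv_smul₀ hpos.ne']
  have hsub : Integrable (fun v => w v • v - w v • m) ρ := hwv.sub (hw.smul_const m)
  have hin : Integrable (fun v => 2 * ⟪a - m, w v • v - w v • m⟫) ρ :=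
    (hsub.const_inner (a - m)).const_mul 2
  have hconst : Integrable (fun v => w v * ‖a - m‖ ^ 2) ρ := hw.mul_const _
  have hcross : ∫ v, 2 * ⟪a - m, w v • v - w v • m⟫ ∂ρ = 2 * (W * ‖a - m‖ ^ 2) := by
    rw [integral_const_mul, integral_inner hsub, integral_sub hwv (hw.smul_const m),
      integral_smul_const, hWa, ← hW, ← smul_sub, real_inner_smul_right,
      real_inner_self_eq_norm_sq]
  calc W * ‖m - a‖ ^ 2
      = ∫ v, (2 * ⟪a - m, w v • v - w v • m⟫ - w v * ‖a - m‖ ^ 2) ∂ρ := by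
        rw [integral_sub hin hconst, hcross, integral_mul_const, ← hW, norm_sub_rev]
        ring
    _ ≤ ∫ v, w v * ‖v - m‖ ^ 2 ∂ρ := by
        refine integral_mono_ae (hin.sub hconst) hsq ?_
        filter_upwards [hnonneg] with v hv
        have h := mul_nonneg hv (sq_nonneg ‖(v - m) - (a - m)‖)
        rw [norm_sub_sq_real, real_inner_comm] at h
        simp only [← smul_sub, real_inner_smul_right]
        linarith

/-- The second moment about a weighted mean is controlled by the variance when the weight is
bounded above. -/
theorem integral_norm_sub_weighted_mean_sq_le [IsProbabilityMeasure ρ] {w : E → ℝ} {M : ℝ}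
    (hw : Integrable w ρ) (hnonneg : ∀ᵐ v ∂ρ, 0 ≤ w v) (hle : ∀ᵐ v ∂ρ, w v ≤ M)
    (hpos : 0 < ∫ v, w v ∂ρ) (hv : Integrable (fun v : E => v) ρ)
    (hsq : Integrable (fun v : E => ‖v - ∫ u, u ∂ρ‖ ^ 2) ρ) :
    ∫ v, ‖v - (∫ u, w u ∂ρ)⁻¹ • ∫ u, w u • u ∂ρ‖ ^ 2 ∂ρ
      ≤ 2 * (M / ∫ v, w v ∂ρ) * ∫ v, ‖v - ∫ u, u ∂ρ‖ ^ 2 ∂ρ := by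
  have hbdd : ∀ᵐ v ∂ρ, ‖w v‖ ≤ M := by
    filter_upwards [hnonneg, hle] with v h0 h1
    rwa [Real.norm_of_nonneg h0]
  have hwv : Integrable (fun v => w v • v) ρ := hv.bdd_smul M hw.aestronglyMeasurable hbdd
  have hwsq : Integrable (fun v => w v * ‖v - ∫ u, u ∂ρ‖ ^ 2) ρ :=
    hsq.bdd_mul hw.aestronglyMeasurable hbdd
  have hjensen :=
    integral_mul_norm_sub_weighted_mean_sq_le hw hnonneg hpos hwv (∫ u, u ∂ρ) hwsq
  rw [integral_norm_sub_sq_eq_add hv hsq]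
  set m := ∫ u, u ∂ρ
  set W := ∫ v, w v ∂ρ with hW
  set S := ∫ v, ‖v - m‖ ^ 2 ∂ρ
  have hS : 0 ≤ S := integral_nonneg fun _ => sq_nonneg _
  have hWM : W ≤ M := by
    have h := integral_mono_ae hw (integrable_const M) hle
    simpa using h
  have hmono : ∫ v, w v * ‖v - m‖ ^ 2 ∂ρ ≤ M * S := by
    rw [← integral_const_mul]
    refine integral_mono_ae hwsq (hsq.const_mul M) ?_
    filter_upwards [hle] with v h
    exact mul_le_mul_of_nonneg_right h (sq_nonneg _)
  have hfirst : S ≤ M / W * S := le_mul_of_one_le_left hS ((one_le_div hpos).2 hWM)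
  have hsecond : ‖m - W⁻¹ • ∫ v, w v • v ∂ρ‖ ^ 2 ≤ M / W * S := by
    rw [div_mul_eq_mul_div, le_div_iff₀' hpos]
    exact hjensen.trans hmono
  linarith

end WeightedMean

/-- Lemma 2.1(1): `∫ |v - v_α(ρ)|² dρ ≤ 4 (exp(-α𝓔̲)/‖ω_α‖) V(ρ) ≤ 4 C_{α,𝓔} V(ρ)`. -/
theorem stmt_0 (d : ℕ) (hd : 2 ≤ d)
    (ρ : Measure (EuclideanSpace ℝ (Fin d))) [IsProbabilityMeasure ρ]
    (hsupp : ∀ᵐ v ∂ρ, v ∈ sph d)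
    (𝓔 : EuclideanSpace ℝ (Fin d) → ℝ) (hmeas : Measurable 𝓔)
    (hbb : BddBelow (𝓔 '' sph d)) (hba : BddAbove (𝓔 '' sph d))
    (α : ℝ) (hα : 0 < α) :
    (∫ v, ‖v - vAlpha 𝓔 α ρ‖ ^ 2 ∂ρ)
        ≤ 4 * (Real.exp (-α * eInf 𝓔) / wNorm 𝓔 α ρ) * varM ρ
      ∧ 4 * (Real.exp (-α * eInf 𝓔) / wNorm 𝓔 α ρ) * varM ρ
        ≤ 4 * Cae 𝓔 α * varM ρ := by
  have hnorm : ∀ᵐ v ∂ρ, ‖v‖ = 1 := by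
    filter_upwards [hsupp] with v hv
    simpa [sph] using hv
  have hlow : ∀ᵐ v ∂ρ, Real.exp (-α * eSup 𝓔) ≤ Real.exp (-α * 𝓔 v) := by
    filter_upwards [hsupp] with v hv
    have h : 𝓔 v ≤ eSup 𝓔 := le_csSup hba (Set.mem_image_of_mem 𝓔 hv)
    exact Real.exp_le_exp.2 (mul_le_mul_of_nonpos_left h (by linarith))
  have hup : ∀ᵐ v ∂ρ, Real.exp (-α * 𝓔 v) ≤ Real.exp (-α * eInf 𝓔) := by
    filter_upwards [hsupp] with v hv
    have h : eInf 𝓔 ≤ 𝓔 v := csInf_le hbb (Set.mem_image_of_mem 𝓔 hv)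
    exact Real.exp_le_exp.2 (mul_le_mul_of_nonpos_left h (by linarith))
  have hw : Integrable (fun v => Real.exp (-α * 𝓔 v)) ρ := by
    refine Integrable.of_bound (by fun_prop) (Real.exp (-α * eInf 𝓔)) ?_
    filter_upwards [hup] with v hv
    rwa [Real.norm_of_nonneg (Real.exp_pos _).le]
  have hv : Integrable (fun v : EuclideanSpace ℝ (Fin d) => v) ρ :=
    Integrable.of_bound (by fun_prop) 1 (hnorm.mono fun v h => h.le)
  have hsq : Integrable (fun v => ‖v - meanM ρ‖ ^ 2) ρ := by
    refine Integrable.of_bound (by fun_prop) ((1 + ‖meanM ρ‖) ^ 2) ?_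
    filter_upwards [hnorm] with v h
    rw [Real.norm_of_nonneg (sq_nonneg _), ← h]
    gcongr
    exact norm_sub_le _ _
  have hW : Real.exp (-α * eSup 𝓔) ≤ wNorm 𝓔 α ρ := by
    simpa [wNorm] using integral_mono_ae (integrable_const _) hw hlow
  have hpos : 0 < wNorm 𝓔 α ρ := (Real.exp_pos _).trans_le hW
  have hvar : 0 ≤ varM ρ :=
    mul_nonneg (by norm_num) (integral_nonneg fun _ => sq_nonneg _)
  constructor
  · refine (integral_norm_sub_weighted_mean_sq_le hw
      (Filter.Eventually.of_forall fun _ => (Real.exp_pos _).le) hup hpos hv hsq).trans_eq ?_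
    simp only [varM, wNorm, meanM]
    ring
  · have hC : Real.exp (-α * eInf 𝓔) / wNorm 𝓔 α ρ ≤ Cae 𝓔 α := by
      rw [div_le_iff₀ hpos]
      refine le_trans (le_of_eq ?_) (mul_le_mul_of_nonneg_left hW (Real.exp_pos _).le)
      rw [Cae, ← Real.exp_add]
      congr 1
      ring
    gcongr
end
end

section
/- Let ρ be a Borel probability measure on 𝕊^{d−1}, let 𝓔 : 𝕊^{d−1} → ℝ be bounded Borel and α > 0. Then ∫_{𝕊^{d−1}} |v − v_α(ρ)| dρ(v) ≤ 2 (exp(−α𝓔̲)/‖ω_α‖_{L¹(ρ)}) V(ρ)^{1/2} ≤ 2 C_{α,𝓔} V(ρ)^{1/2}. -/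
open MeasureTheory Real RealInnerProductSpace

noncomputable section

section

variable {Ω : Type*} [MeasurableSpace Ω] {μ : Measure Ω} [IsProbabilityMeasure μ]

/-- The first moment of a square-integrable function is at most the root of its second moment. -/
lemma integral_le_sqrt_integral_sq {g : Ω → ℝ} (hg : Integrable g μ)
    (hg2 : Integrable (fun x => g x ^ 2) μ) :
    ∫ x, g x ∂μ ≤ √(∫ x, g x ^ 2 ∂μ) := by
  apply Real.le_sqrt_of_sq_le
  set m := ∫ x, g x ∂μ with hm
  have h0 : 0 ≤ ∫ x, (g x ^ 2 - 2 * m * g x + m ^ 2) ∂μ :=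
    integral_nonneg fun x => by
      change 0 ≤ g x ^ 2 - 2 * m * g x + m ^ 2
      nlinarith [sq_nonneg (g x - m)]
  have hsub : Integrable (fun x => g x ^ 2 - 2 * m * g x) μ := hg2.sub (hg.const_mul _)
  rw [integral_add hsub (integrable_const _),
    integral_sub hg2 (hg.const_mul _), integral_const_mul, ← hm] at h0
  simp at h0
  nlinarith

variable {F : Type*} [NormedAddCommGroup F] [InnerProductSpace ℝ F] [CompleteSpace F]

/-- The second moment about `a` is the second moment about the mean plus `‖mean - a‖ ^ 2`. -/
lemma integral_norm_sub_sq_eq {f : Ω → F} (hf : Integrable f μ)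
    (hf2 : Integrable (fun x => ‖f x - ∫ y, f y ∂μ‖ ^ 2) μ) (a : F) :
    ∫ x, ‖f x - a‖ ^ 2 ∂μ
      = ∫ x, ‖f x - ∫ y, f y ∂μ‖ ^ 2 ∂μ + ‖(∫ y, f y ∂μ) - a‖ ^ 2 := by
  set m := ∫ y, f y ∂μ with hm
  have hfm : Integrable (fun x => f x - m) μ := hf.sub (integrable_const _)
  have hz : ∫ x, inner ℝ (m - a) (f x - m) ∂μ = 0 := by
    rw [integral_inner hfm, integral_sub hf (integrable_const _)]
    simp [← hm]
  have hi : Integrable (fun x => inner ℝ (m - a) (f x - m)) μ := hfm.const_inner _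
  have hpt : ∀ x, ‖f x - a‖ ^ 2
      = ‖f x - m‖ ^ 2 + 2 * inner ℝ (m - a) (f x - m) + ‖m - a‖ ^ 2 := fun x => by
    rw [← sub_add_sub_cancel (f x) m a, norm_add_sq_real, real_inner_comm]
  simp_rw [hpt]
  have hadd : Integrable (fun x => ‖f x - m‖ ^ 2 + 2 * inner ℝ (m - a) (f x - m)) μ :=
    hf2.add (hi.const_mul _)
  rw [integral_add hadd (integrable_const _),
    integral_add hf2 (hi.const_mul _), integral_const_mul, hz]
  simp

/-- A weighted mean with weight `w ≤ M` differs from `a` by at most `M / ∫ w` times the mean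
distance to `a`. -/
lemma norm_sub_weighted_mean_le {f : Ω → F} {w : Ω → ℝ} {M : ℝ} (a : F) (hf : Integrable f μ)
    (hw : Integrable w μ) (hwf : Integrable (fun x => w x • f x) μ)
    (hw0 : ∀ x, 0 ≤ w x) (hwM : ∀ᵐ x ∂μ, w x ≤ M) (hpos : 0 < ∫ x, w x ∂μ) :
    ‖a - (∫ x, w x ∂μ)⁻¹ • ∫ x, w x • f x ∂μ‖
      ≤ M / (∫ x, w x ∂μ) * ∫ x, ‖f x - a‖ ∂μ := by
  set W := ∫ x, w x ∂μ with hW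
  have hdiff : a - W⁻¹ • ∫ x, w x • f x ∂μ = -(W⁻¹ • ∫ x, w x • (f x - a) ∂μ) := by
    simp_rw [smul_sub]
    rw [integral_sub hwf (hw.smul_const a), integral_smul_const, ← hW, smul_sub,
      inv_smul_smul₀ hpos.ne', neg_sub]
  have hb : ‖∫ x, w x • (f x - a) ∂μ‖ ≤ M * ∫ x, ‖f x - a‖ ∂μ := by
    rw [← integral_const_mul]
    refine norm_integral_le_of_norm_le ((hf.sub (integrable_const a)).norm.const_mul M) ?_
    filter_upwards [hwM] with x hx
    rw [norm_smul, Real.norm_of_nonneg (hw0 x)]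
    exact mul_le_mul_of_nonneg_right hx (norm_nonneg _)
  rw [hdiff, norm_neg, norm_smul, norm_inv, Real.norm_of_nonneg hpos.le, div_mul_eq_mul_div,
    inv_mul_eq_div]
  exact div_le_div_of_nonneg_right hb hpos.le

end

/-- Lemma 2.1(2): `∫ |v - v_α(ρ)| dρ ≤ 2 (exp(-α𝓔̲)/‖ω_α‖) V(ρ)^{1/2} ≤ 2 C_{α,𝓔} V(ρ)^{1/2}`. -/
theorem stmt_1 (d : ℕ) (hd : 2 ≤ d)
    (ρ : Measure (EuclideanSpace ℝ (Fin d))) [IsProbabilityMeasure ρ]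
    (hsupp : ∀ᵐ v ∂ρ, v ∈ sph d)
    (𝓔 : EuclideanSpace ℝ (Fin d) → ℝ) (hmeas : Measurable 𝓔)
    (hbb : BddBelow (𝓔 '' sph d)) (hba : BddAbove (𝓔 '' sph d))
    (α : ℝ) (hα : 0 < α) :
    (∫ v, ‖v - vAlpha 𝓔 α ρ‖ ∂ρ)
        ≤ 2 * (Real.exp (-α * eInf 𝓔) / wNorm 𝓔 α ρ) * Real.sqrt (varM ρ)
      ∧ 2 * (Real.exp (-α * eInf 𝓔) / wNorm 𝓔 α ρ) * Real.sqrt (varM ρ)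
        ≤ 2 * Cae 𝓔 α * Real.sqrt (varM ρ) := by
  have hle : ∀ᵐ v ∂ρ, Real.exp (-α * 𝓔 v) ≤ Real.exp (-α * eInf 𝓔) := by
    filter_upwards [hsupp] with v hv
    have : eInf 𝓔 ≤ 𝓔 v := csInf_le hbb ⟨v, hv, rfl⟩
    exact Real.exp_le_exp.2 (by nlinarith)
  have hge : ∀ᵐ v ∂ρ, Real.exp (-α * eSup 𝓔) ≤ Real.exp (-α * 𝓔 v) := by
    filter_upwards [hsupp] with v hv
    have : 𝓔 v ≤ eSup 𝓔 := le_csSup hba ⟨v, hv, rfl⟩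
    exact Real.exp_le_exp.2 (by nlinarith)
  have hnorm : ∀ᵐ v ∂ρ, ‖v‖ = 1 := by
    filter_upwards [hsupp] with v hv
    simpa [sph] using hv
  have hwm : Measurable fun v => Real.exp (-α * 𝓔 v) := (hmeas.const_mul _).exp
  have hw : Integrable (fun v => Real.exp (-α * 𝓔 v)) ρ := by
    refine Integrable.of_bound hwm.aestronglyMeasurable (Real.exp (-α * eInf 𝓔)) ?_
    filter_upwards [hle] with v hv
    rwa [Real.norm_of_nonneg (Real.exp_pos _).le]
  have hid : Integrable (fun v : EuclideanSpace ℝ (Fin d) => v) ρ :=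
    Integrable.of_bound measurable_id.aestronglyMeasurable 1 (hnorm.mono fun v hv => hv.le)
  have hwid : Integrable (fun v => Real.exp (-α * 𝓔 v) • v) ρ := by
    refine Integrable.of_bound (hwm.smul measurable_id).aestronglyMeasurable
      (Real.exp (-α * eInf 𝓔)) ?_
    filter_upwards [hle, hnorm] with v hv hv1
    rwa [norm_smul, hv1, mul_one, Real.norm_of_nonneg (Real.exp_pos _).le]
  have hdist : ∀ a : EuclideanSpace ℝ (Fin d), Integrable (fun v => ‖v - a‖) ρ := fun a =>
    (hid.sub (integrable_const a)).norm
  have hdist2 : ∀ a : EuclideanSpace ℝ (Fin d), Integrable (fun v => ‖v - a‖ ^ 2) ρ := by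
    intro a
    refine Integrable.of_bound (by fun_prop) ((1 + ‖a‖) ^ 2) ?_
    filter_upwards [hnorm] with v hv
    rw [Real.norm_of_nonneg (sq_nonneg _)]
    exact pow_le_pow_left₀ (norm_nonneg _) (hv ▸ norm_sub_le v a) 2
  have hW_ge : Real.exp (-α * eSup 𝓔) ≤ wNorm 𝓔 α ρ := by
    simpa [wNorm] using integral_mono_ae (integrable_const _) hw hge
  have hW_le : wNorm 𝓔 α ρ ≤ Real.exp (-α * eInf 𝓔) := by
    simpa [wNorm] using integral_mono_ae hw (integrable_const _) hle
  have hW : 0 < wNorm 𝓔 α ρ := (Real.exp_pos _).trans_le hW_ge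
  have hvar : ∫ v, ‖v - meanM ρ‖ ^ 2 ∂ρ = 2 * varM ρ := by
    rw [varM]; ring
  have hV : 0 ≤ varM ρ :=
    mul_nonneg (by norm_num) (integral_nonneg fun v => sq_nonneg _)
  constructor
  · set K := Real.exp (-α * eInf 𝓔) / wNorm 𝓔 α ρ with hK
    have hK1 : 1 ≤ K := (one_le_div hW).2 hW_le
    have hmean : ‖meanM ρ - vAlpha 𝓔 α ρ‖ ≤ K * √(2 * varM ρ) := by
      refine (norm_sub_weighted_mean_le (meanM ρ) hid hw hwid
        (fun v => (Real.exp_pos _).le) hle hW).trans ?_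
      rw [← hvar]
      exact mul_le_mul_of_nonneg_left
        (integral_le_sqrt_integral_sq (hdist _) (hdist2 _)) (zero_le_one.trans hK1)
    have hmean2 : ‖meanM ρ - vAlpha 𝓔 α ρ‖ ^ 2 ≤ K ^ 2 * (2 * varM ρ) := by
      have h := pow_le_pow_left₀ (norm_nonneg _) hmean 2
      rwa [mul_pow, Real.sq_sqrt (by positivity)] at h
    have hsplit : ∫ v, ‖v - vAlpha 𝓔 α ρ‖ ^ 2 ∂ρ
        = 2 * varM ρ + ‖meanM ρ - vAlpha 𝓔 α ρ‖ ^ 2 := by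
      rw [← hvar]
      exact integral_norm_sub_sq_eq hid (hdist2 _) _
    refine (integral_le_sqrt_integral_sq (hdist _) (hdist2 _)).trans ?_
    refine Real.sqrt_le_iff.2 ⟨by positivity, ?_⟩
    rw [hsplit, mul_pow, Real.sq_sqrt hV]
    nlinarith [mul_nonneg (sub_nonneg.2 (one_le_pow₀ hK1 : 1 ≤ K ^ 2)) hV]
  · have hKC : Real.exp (-α * eInf 𝓔) / wNorm 𝓔 α ρ ≤ Cae 𝓔 α := by
      rw [div_le_iff₀ hW]
      calc Real.exp (-α * eInf 𝓔) = Cae 𝓔 α * Real.exp (-α * eSup 𝓔) := by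
            rw [Cae, ← Real.exp_add]; ring_nf
        _ ≤ Cae 𝓔 α * wNorm 𝓔 α ρ :=
            mul_le_mul_of_nonneg_left hW_ge (Real.exp_pos _).le
    gcongr
end
end

section
/- Let ρ be a Borel probability measure on 𝕊^{d−1} with V(ρ) ≤ 3/8, let α > 0, and let 𝓔 : 𝕊^{d−1} → ℝ be bounded and c₁-Lipschitz, i.e. |𝓔(u) − 𝓔(v)| ≤ c₁|u − v| for all u, v ∈ 𝕊^{d−1}. Then | −(1/α) log ‖ω_α‖_{L¹(ρ)} − 𝓔( E(ρ)/|E(ρ)| ) | ≤ 2√(2/3) c₁ C_{α,𝓔} V(ρ)^{1/2}. -/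
open MeasureTheory Real RealInnerProductSpace

noncomputable section

/-- Two-sided bound on the cumulant `log ∫ exp t` of a bounded function `t`. -/
lemma abs_log_integral_exp_le {Ω : Type*} [MeasurableSpace Ω] (ρ : Measure Ω)
    [IsProbabilityMeasure ρ] {t : Ω → ℝ} (ht : Measurable t) {M : ℝ} (hM : ∀ᵐ x ∂ρ, |t x| ≤ M) :
    |Real.log (∫ x, Real.exp (t x) ∂ρ)| ≤ Real.exp M * ∫ x, |t x| ∂ρ := by
  have hti : Integrable t ρ := Integrable.of_bound ht.aestronglyMeasurable M hM
  have hei : Integrable (fun x => Real.exp (t x)) ρ := by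
    refine Integrable.of_bound ht.exp.aestronglyMeasurable (Real.exp M) ?_
    filter_upwards [hM] with x hx
    rw [Real.norm_eq_abs, Real.abs_exp]
    exact Real.exp_le_exp.2 ((le_abs_self _).trans hx)
  have hpos : 0 < ∫ x, Real.exp (t x) ∂ρ := integral_exp_pos hei
  have hM0 : 0 ≤ M := by
    obtain ⟨x, hx⟩ := hM.exists
    exact (abs_nonneg _).trans hx
  have habs : 0 ≤ ∫ x, |t x| ∂ρ := integral_nonneg fun x => abs_nonneg _
  rw [abs_le]
  constructor
  · have jensen : ∫ x, t x ∂ρ ≤ Real.log (∫ x, Real.exp (t x) ∂ρ) := by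
      set X := ∫ x, Real.exp (t x) ∂ρ with hX
      have h : ∫ x, t x ∂ρ ≤ ∫ x, (Real.exp (t x) * X⁻¹ + (Real.log X - 1)) ∂ρ := by
        refine integral_mono hti ((hei.mul_const _).add (integrable_const _)) fun x => ?_
        have h1 := Real.add_one_le_exp (t x - Real.log X)
        rw [Real.exp_sub, Real.exp_log hpos, div_eq_mul_inv] at h1
        simp only
        linarith
      rw [integral_add (hei.mul_const _) (integrable_const _), integral_mul_const, ← hX,
        mul_inv_cancel₀ hpos.ne'] at h
      simp only [integral_const, probReal_univ, one_smul] at h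
      linarith
    have h2 : -∫ x, |t x| ∂ρ ≤ ∫ x, t x ∂ρ :=
      (abs_le.1 (abs_integral_le_integral_abs (f := t) (μ := ρ))).1
    have h3 : 1 * ∫ x, |t x| ∂ρ ≤ Real.exp M * ∫ x, |t x| ∂ρ :=
      mul_le_mul_of_nonneg_right (Real.one_le_exp hM0) habs
    linarith
  · have h : ∫ x, Real.exp (t x) ∂ρ ≤ ∫ x, (Real.exp M * |t x| + 1) ∂ρ := by
      refine integral_mono_ae hei ((hti.abs.const_mul _).add (integrable_const _)) ?_
      filter_upwards [hM] with x hx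
      have h1 := Real.add_one_le_exp (-t x)
      have h2 : Real.exp (t x) * Real.exp (-t x) = 1 := by
        rw [← Real.exp_add, add_neg_cancel, Real.exp_zero]
      have h3 : Real.exp (t x) ≤ Real.exp M :=
        Real.exp_le_exp.2 ((le_abs_self _).trans hx)
      nlinarith [mul_le_mul_of_nonneg_left h1 (Real.exp_pos (t x)).le,
        mul_le_mul_of_nonneg_left (le_abs_self (t x)) (Real.exp_pos (t x)).le,
        mul_le_mul_of_nonneg_right h3 (abs_nonneg (t x))]
    rw [integral_add (hti.abs.const_mul _) (integrable_const _), integral_const_mul] at h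
    simp only [integral_const, probReal_univ, one_smul] at h
    linarith [Real.log_le_sub_one_of_pos hpos]

lemma sq_integral_le_integral_sq {Ω : Type*} [MeasurableSpace Ω] (ρ : Measure Ω)
    [IsProbabilityMeasure ρ] {f : Ω → ℝ} (hf : MemLp f 2 ρ) :
    (∫ x, f x ∂ρ) ^ 2 ≤ ∫ x, f x ^ 2 ∂ρ := by
  have h := ProbabilityTheory.variance_nonneg f ρ
  rw [ProbabilityTheory.variance_eq_sub hf] at h
  simpa using h

section Sphere

variable {d : ℕ} {ρ : Measure (EuclideanSpace ℝ (Fin d))} [IsProbabilityMeasure ρ]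

lemma integral_norm_sub_sq_of_ae_mem_sph (hsupp : ∀ᵐ v ∂ρ, v ∈ sph d)
    (a : EuclideanSpace ℝ (Fin d)) :
    ∫ v, ‖v - a‖ ^ 2 ∂ρ = 1 - 2 * ⟪a, meanM ρ⟫ + ‖a‖ ^ 2 := by
  have hnorm : ∀ᵐ v ∂ρ, ‖v‖ = 1 := by
    filter_upwards [hsupp] with v hv
    simpa [sph] using hv
  have hid : Integrable (fun v : EuclideanSpace ℝ (Fin d) => v) ρ :=
    Integrable.of_bound measurable_id.aestronglyMeasurable 1 (hnorm.mono fun v hv => hv.le)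
  have hin : Integrable (fun v => ⟪a, v⟫) ρ := hid.const_inner a
  calc ∫ v, ‖v - a‖ ^ 2 ∂ρ = ∫ v, ((1 + ‖a‖ ^ 2) - 2 * ⟪a, v⟫) ∂ρ := by
        refine integral_congr_ae ?_
        filter_upwards [hnorm] with v hv
        rw [norm_sub_sq_real, hv, real_inner_comm]
        ring
    _ = (1 + ‖a‖ ^ 2) - 2 * ⟪a, meanM ρ⟫ := by
        rw [integral_sub (integrable_const _) (hin.const_mul 2), integral_const_mul,
          integral_inner hid, meanM]
        simp
    _ = 1 - 2 * ⟪a, meanM ρ⟫ + ‖a‖ ^ 2 := by ring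

lemma norm_meanM_sq (hsupp : ∀ᵐ v ∂ρ, v ∈ sph d) : ‖meanM ρ‖ ^ 2 = 1 - 2 * varM ρ := by
  rw [varM, integral_norm_sub_sq_of_ae_mem_sph hsupp, real_inner_self_eq_norm_sq]
  ring

lemma half_le_norm_meanM (hsupp : ∀ᵐ v ∂ρ, v ∈ sph d) (hV : varM ρ ≤ 3 / 8) :
    1 / 2 ≤ ‖meanM ρ‖ := by
  nlinarith [norm_meanM_sq hsupp, norm_nonneg (meanM ρ)]

lemma normalized_meanM_mem_sph (hsupp : ∀ᵐ v ∂ρ, v ∈ sph d) (hV : varM ρ ≤ 3 / 8) :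
    ‖meanM ρ‖⁻¹ • meanM ρ ∈ sph d := by
  have h := half_le_norm_meanM hsupp hV
  have h0 : ‖meanM ρ‖ ≠ 0 := by linarith
  simp [sph, norm_smul, h0]

lemma memLp_norm_sub (hsupp : ∀ᵐ v ∂ρ, v ∈ sph d) (u : EuclideanSpace ℝ (Fin d)) :
    MemLp (fun v => ‖v - u‖) 2 ρ := by
  refine MemLp.of_bound (by fun_prop) (1 + ‖u‖) ?_
  filter_upwards [hsupp] with v hv
  have hv : ‖v‖ = 1 := by simpa [sph] using hv
  simpa [hv] using norm_sub_le v u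

lemma integral_norm_sub_normalized_meanM_le (hsupp : ∀ᵐ v ∂ρ, v ∈ sph d)
    (hV : varM ρ ≤ 3 / 8) :
    ∫ v, ‖v - ‖meanM ρ‖⁻¹ • meanM ρ‖ ∂ρ ≤ 2 * √(2 / 3) * √(varM ρ) := by
  have hr := half_le_norm_meanM hsupp hV
  have hu : ‖‖meanM ρ‖⁻¹ • meanM ρ‖ = 1 := by
    simpa [sph] using normalized_meanM_mem_sph hsupp hV
  have hV0 : 0 ≤ varM ρ := mul_nonneg (by norm_num) (integral_nonneg fun v => by positivity)
  refine abs_le_of_sq_le_sq' ?_ (by positivity) |>.2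
  refine (sq_integral_le_integral_sq ρ (memLp_norm_sub hsupp _)).trans ?_
  rw [integral_norm_sub_sq_of_ae_mem_sph hsupp, hu, real_inner_smul_left,
    real_inner_self_eq_norm_sq, mul_pow, mul_pow, Real.sq_sqrt (by norm_num), Real.sq_sqrt hV0]
  have h1 : ‖meanM ρ‖⁻¹ * ‖meanM ρ‖ ^ 2 = ‖meanM ρ‖ := by
    field_simp
  rw [h1]
  have h2 := norm_meanM_sq hsupp
  nlinarith

end Sphere

/-- Estimate from the proof of Proposition 2.1:
`|-(1/α) log ‖ω_α‖_{L¹(ρ)} - 𝓔(E(ρ)/|E(ρ)|)| ≤ 2√(2/3) c₁ C_{α,𝓔} V(ρ)^{1/2}`. -/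
theorem stmt_4 (d : ℕ) (hd : 2 ≤ d)
    (ρ : Measure (EuclideanSpace ℝ (Fin d))) [IsProbabilityMeasure ρ]
    (hsupp : ∀ᵐ v ∂ρ, v ∈ sph d)
    (𝓔 : EuclideanSpace ℝ (Fin d) → ℝ) (hmeas : Measurable 𝓔)
    (hbb : BddBelow (𝓔 '' sph d)) (hba : BddAbove (𝓔 '' sph d))
    (c₁ : ℝ) (hc₁ : 0 ≤ c₁)
    (hLip : ∀ u ∈ sph d, ∀ v ∈ sph d, |𝓔 u - 𝓔 v| ≤ c₁ * ‖u - v‖)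
    (α : ℝ) (hα : 0 < α)
    (hV : varM ρ ≤ 3/8) :
    |(-(1/α)) * Real.log (wNorm 𝓔 α ρ) - 𝓔 (‖meanM ρ‖⁻¹ • meanM ρ)|
      ≤ 2 * Real.sqrt (2/3) * c₁ * Cae 𝓔 α * Real.sqrt (varM ρ) := by
  set u := ‖meanM ρ‖⁻¹ • meanM ρ with hu
  have hus : u ∈ sph d := normalized_meanM_mem_sph hsupp hV
  have hdist : ∫ v, ‖v - u‖ ∂ρ ≤ 2 * √(2 / 3) * √(varM ρ) :=
    integral_norm_sub_normalized_meanM_le hsupp hV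
  have hbound : ∀ᵐ v ∂ρ, |-α * (𝓔 v - 𝓔 u)| ≤ α * (eSup 𝓔 - eInf 𝓔) := by
    filter_upwards [hsupp] with v hv
    rw [abs_mul, abs_neg, abs_of_pos hα]
    refine mul_le_mul_of_nonneg_left ?_ hα.le
    have h1 : 𝓔 v ≤ eSup 𝓔 := le_csSup hba ⟨v, hv, rfl⟩
    have h2 : 𝓔 u ≤ eSup 𝓔 := le_csSup hba ⟨u, hus, rfl⟩
    have h3 : eInf 𝓔 ≤ 𝓔 v := csInf_le hbb ⟨v, hv, rfl⟩
    have h4 : eInf 𝓔 ≤ 𝓔 u := csInf_le hbb ⟨u, hus, rfl⟩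
    rw [abs_le]
    constructor <;> linarith
  have hmeas' : Measurable fun v => -α * (𝓔 v - 𝓔 u) := by fun_prop
  have hcum := abs_log_integral_exp_le ρ hmeas' hbound
  have hcenter : ∫ v, Real.exp (-α * (𝓔 v - 𝓔 u)) ∂ρ = wNorm 𝓔 α ρ * Real.exp (α * 𝓔 u) := by
    rw [wNorm, ← integral_mul_const]
    refine integral_congr_ae (Filter.Eventually.of_forall fun v => ?_)
    simp only
    rw [← Real.exp_add]
    ring_nf
  have hwi : Integrable (fun v => Real.exp (-α * 𝓔 v)) ρ := by
    refine Integrable.of_bound (by fun_prop) (Real.exp (-α * eInf 𝓔)) ?_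
    filter_upwards [hsupp] with v hv
    rw [Real.norm_eq_abs, Real.abs_exp, Real.exp_le_exp]
    have h3 : eInf 𝓔 ≤ 𝓔 v := csInf_le hbb ⟨v, hv, rfl⟩
    nlinarith
  have hw : 0 < wNorm 𝓔 α ρ := integral_exp_pos hwi
  rw [hcenter, Real.log_mul hw.ne' (Real.exp_pos _).ne', Real.log_exp] at hcum
  have hint : ∫ v, |-α * (𝓔 v - 𝓔 u)| ∂ρ ≤ α * c₁ * ∫ v, ‖v - u‖ ∂ρ := by
    rw [← integral_const_mul]
    refine integral_mono_ae (Integrable.of_bound hmeas'.aestronglyMeasurable _ hbound).abs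
      (((memLp_norm_sub hsupp u).integrable (by norm_num)).const_mul _) ?_
    filter_upwards [hsupp] with v hv
    rw [abs_mul, abs_neg, abs_of_pos hα, mul_assoc]
    exact mul_le_mul_of_nonneg_left (hLip v hv u hus) hα.le
  have hrw : -(1 / α) * Real.log (wNorm 𝓔 α ρ) - 𝓔 u
      = -(1 / α) * (Real.log (wNorm 𝓔 α ρ) + α * 𝓔 u) := by
    field_simp
    ring
  rw [hrw, abs_mul, abs_neg, abs_of_pos (by positivity : 0 < 1 / α)]
  calc 1 / α * |Real.log (wNorm 𝓔 α ρ) + α * 𝓔 u|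
      ≤ 1 / α * (Cae 𝓔 α * (α * c₁ * (2 * √(2 / 3) * √(varM ρ)))) := by
        refine mul_le_mul_of_nonneg_left (hcum.trans ?_) (by positivity)
        exact mul_le_mul_of_nonneg_left
          (hint.trans (mul_le_mul_of_nonneg_left hdist (by positivity))) (Real.exp_pos _).le
    _ = 2 * √(2 / 3) * c₁ * Cae 𝓔 α * √(varM ρ) := by
        field_simp
end
end

section
/- Let 𝓔 : 𝕊^{d−1} → ℝ be bounded with 𝓔̲ ≤ 𝓔 ≤ 𝓔̄ and L-Lipschitz on 𝕊^{d−1}, i.e. |𝓔(u) − 𝓔(v)| ≤ L|u − v| for all u, v ∈ 𝕊^{d−1}, and let α > 0. Then there exists a constant C > 0 depending only on α, L, 𝓔̲ and 𝓔̄ (in particular independent of N and d) such that for every N ∈ ℕ and all tuples V = (V¹, …, V^N) and V̂ = (V̂¹, …, V̂^N) of points of 𝕊^{d−1} one has | v_α(V) − v_α(V̂) | ≤ C · (1/N) Σ_{j=1}^N |V^j − V̂^j|. -/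
open MeasureTheory Real RealInnerProductSpace

noncomputable section

/-- The exponential is Lipschitz with constant `exp c` on `(-∞, c]`. -/
theorem abs_exp_sub_exp_le {x y c : ℝ} (hx : x ≤ c) (hy : y ≤ c) :
    |Real.exp x - Real.exp y| ≤ Real.exp c * |x - y| := by
  wlog h : y ≤ x generalizing x y
  · rw [abs_sub_comm, abs_sub_comm x]
    exact this hy hx (le_of_not_ge h)
  rw [abs_of_nonneg (sub_nonneg.2 (Real.exp_le_exp.2 h)), abs_of_nonneg (sub_nonneg.2 h)]
  calc Real.exp x - Real.exp y = Real.exp x * (1 - Real.exp (y - x)) := by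
        rw [mul_sub, ← Real.exp_add, mul_one, add_sub_cancel]
    _ ≤ Real.exp x * (x - y) := by
        refine mul_le_mul_of_nonneg_left ?_ (Real.exp_pos x).le
        linarith [Real.add_one_le_exp (y - x)]
    _ ≤ Real.exp c * (x - y) := by
        have := sub_nonneg.2 h
        gcongr

/-- Stability of weighted means of points in the unit ball under perturbation of the points,
when the weights are bounded above and below and depend on the points in a Lipschitz way. -/
theorem norm_centerMass_sub_centerMass_le {ι E : Type*} [Fintype ι] [NormedAddCommGroup E]
    [NormedSpace ℝ E] {w w' : ι → ℝ} {x y : ι → E} {m M K : ℝ} (hm : 0 < m)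
    (hmw : ∀ i, m ≤ w i) (hwM : ∀ i, w i ≤ M) (hw' : ∀ i, 0 < w' i) (hy : ∀ i, ‖y i‖ ≤ 1)
    (hK : ∀ i, |w i - w' i| ≤ K * ‖x i - y i‖) :
    ‖Finset.univ.centerMass w x - Finset.univ.centerMass w' y‖
      ≤ (M + 2 * K) / m * ((Fintype.card ι : ℝ)⁻¹ * ∑ i, ‖x i - y i‖) := by
  cases isEmpty_or_nonempty ι
  · simp [Finset.centerMass]
  have hW' : 0 < ∑ i, w' i := Finset.sum_pos (fun i _ => hw' i) Finset.univ_nonempty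
  set b := Finset.univ.centerMass w' y with hb
  have hb1 : ‖b‖ ≤ 1 := by
    have : b ∈ Metric.closedBall (0 : E) 1 :=
      (convex_closedBall (0 : E) 1).centerMass_mem (fun i _ => (hw' i).le) hW'
        (fun i _ => by simpa using hy i)
    simpa using this
  have hW'b : ∑ i, w' i • y i = (∑ i, w' i) • b := by
    rw [hb, Finset.centerMass, smul_inv_smul₀ hW'.ne']
  have hcard : 0 < (Fintype.card ι : ℝ) := by exact_mod_cast Fintype.card_pos
  have hW : Fintype.card ι * m ≤ ∑ i, w i := by
    simpa using Finset.card_nsmul_le_sum Finset.univ w m (fun i _ => hmw i)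
  have hWpos : 0 < ∑ i, w i := (mul_pos hcard hm).trans_le hW
  have key : Finset.univ.centerMass w x - b
      = (∑ i, w i)⁻¹ • ∑ i, (w i • (x i - y i) + (w i - w' i) • (y i - b)) := by
    have : ∑ i, (w i • (x i - y i) + (w i - w' i) • (y i - b))
        = ∑ i, w i • x i - (∑ i, w i) • b := by
      simp only [smul_sub, sub_smul, Finset.sum_add_distrib, Finset.sum_sub_distrib, hW'b,
        Finset.sum_smul]
      abel
    rw [this, smul_sub, inv_smul_smul₀ hWpos.ne', Finset.centerMass]
  have hterm : ∀ i, ‖w i • (x i - y i) + (w i - w' i) • (y i - b)‖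
      ≤ (M + 2 * K) * ‖x i - y i‖ := fun i => by
    have hyb : ‖y i - b‖ ≤ 2 := (norm_sub_le _ _).trans (by linarith [hy i])
    calc _ ≤ |w i| * ‖x i - y i‖ + |w i - w' i| * ‖y i - b‖ := by
          refine (norm_add_le _ _).trans_eq ?_
          rw [norm_smul, norm_smul, Real.norm_eq_abs, Real.norm_eq_abs]
      _ ≤ M * ‖x i - y i‖ + K * ‖x i - y i‖ * 2 := by
          rw [abs_of_pos (hm.trans_le (hmw i))]
          have := (abs_nonneg _).trans (hK i)
          gcongr
          exacts [hwM i, hK i]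
      _ = _ := by ring
  have hsum : ‖∑ i, (w i • (x i - y i) + (w i - w' i) • (y i - b))‖
      ≤ (M + 2 * K) * ∑ i, ‖x i - y i‖ := by
    rw [Finset.mul_sum]
    exact norm_sum_le_of_le _ fun i _ => hterm i
  calc ‖Finset.univ.centerMass w x - b‖
      = (∑ i, w i)⁻¹ * ‖∑ i, (w i • (x i - y i) + (w i - w' i) • (y i - b))‖ := by
        rw [key, norm_smul, Real.norm_of_nonneg (inv_nonneg.2 hWpos.le)]
    _ ≤ (Fintype.card ι * m)⁻¹ * ((M + 2 * K) * ∑ i, ‖x i - y i‖) := by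
        gcongr
    _ = _ := by
        rw [mul_inv]
        ring

/-- Lipschitz stability of the empirical consensus point: there is a constant `C > 0`
depending only on `α, L, 𝓔̲, 𝓔̄` (independent of `N` and `d`) such that
`|v_α(V) - v_α(V̂)| ≤ C (1/N) Σ_j |V^j - V̂^j|`. -/
theorem stmt_7 (α L elow eup : ℝ) (hα : 0 < α) (hL : 0 ≤ L) :
    ∃ C : ℝ, 0 < C ∧
      ∀ d : ℕ, 2 ≤ d →
        ∀ 𝓔 : EuclideanSpace ℝ (Fin d) → ℝ,
          (∀ v ∈ sph d, elow ≤ 𝓔 v ∧ 𝓔 v ≤ eup) →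
          (∀ u ∈ sph d, ∀ v ∈ sph d, |𝓔 u - 𝓔 v| ≤ L * ‖u - v‖) →
          ∀ (N : ℕ) (V Vh : Fin N → EuclideanSpace ℝ (Fin d)),
            (∀ j, V j ∈ sph d) → (∀ j, Vh j ∈ sph d) →
            ‖(∑ j, Real.exp (-α * 𝓔 (V j)))⁻¹ • (∑ j, Real.exp (-α * 𝓔 (V j)) • V j)
                - (∑ j, Real.exp (-α * 𝓔 (Vh j)))⁻¹ • (∑ j, Real.exp (-α * 𝓔 (Vh j)) • Vh j)‖
              ≤ C * ((N : ℝ)⁻¹ * ∑ j, ‖V j - Vh j‖) := by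
  refine ⟨(Real.exp (-α * elow) + 2 * (Real.exp (-α * elow) * (α * L))) / Real.exp (-α * eup),
    by positivity, fun d _ 𝓔 hbd hLip N V Vh hV hVh => ?_⟩
  have hle : ∀ v ∈ sph d, -α * 𝓔 v ≤ -α * elow := fun v hv =>
    mul_le_mul_of_nonpos_left (hbd v hv).1 (by linarith)
  have hge : ∀ v ∈ sph d, -α * eup ≤ -α * 𝓔 v := fun v hv =>
    mul_le_mul_of_nonpos_left (hbd v hv).2 (by linarith)
  have h := norm_centerMass_sub_centerMass_le (x := V) (y := Vh)
    (w := fun j => Real.exp (-α * 𝓔 (V j))) (w' := fun j => Real.exp (-α * 𝓔 (Vh j)))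
    (K := Real.exp (-α * elow) * (α * L)) (Real.exp_pos (-α * eup))
    (fun j => Real.exp_le_exp.2 (hge _ (hV j))) (fun j => Real.exp_le_exp.2 (hle _ (hV j)))
    (fun j => Real.exp_pos _) (fun j => (mem_sphere_zero_iff_norm.1 (hVh j)).le) fun j => by
      refine (abs_exp_sub_exp_le (hle _ (hV j)) (hle _ (hVh j))).trans ?_
      rw [← mul_sub, abs_mul, abs_neg, abs_of_pos hα, mul_assoc, mul_assoc]
      gcongr
      exact hLip _ (hV j) _ (hVh j)
  rwa [Fintype.card_fin] at h
end
end

section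
/- Let f : ℝ^d → ℝ be twice continuously differentiable, let r(u) = u/|u| for u ≠ 0, let g = f ∘ r, and for a fixed index i let h_i = (∂_i g) ∘ r. Then for every v with |v| = 1, ∂_i h_i(v) = ∂²_{ii} f(v) − 2 Σ_{j=1}^d ∂²_{ij} f(v) v_j v_i − ⟨v, ∇f(v)⟩ + 2 v_i² ⟨v, ∇f(v)⟩ − v_i ∂_i f(v) + v_i² ⟨∇²f(v) v, v⟩. -/
open MeasureTheory Real RealInnerProductSpace

noncomputable section

section Normalize

variable {E : Type*} [NormedAddCommGroup E] [InnerProductSpace ℝ E]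

/-- The derivative of the radial projection `u ↦ u / ‖u‖` at a unit vector is the orthogonal
projection onto its orthogonal complement. -/
theorem hasFDerivAt_inv_norm_smul {v : E} (hv : ‖v‖ = 1) :
    HasFDerivAt (fun u : E => ‖u‖⁻¹ • u)
      (ContinuousLinearMap.id ℝ E - (innerSL ℝ v).smulRight v) v := by
  have hsq : HasFDerivAt (fun u : E => ‖u‖ ^ 2) (2 • innerSL ℝ v) v :=
    (hasStrictFDerivAt_norm_sq v).hasFDerivAt
  have hnorm : HasFDerivAt (fun u : E => ‖u‖) (innerSL ℝ v) v := by
    have h := hsq.sqrt (by simp [hv])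
    simp only [Real.sqrt_sq (norm_nonneg _), hv] at h
    refine h.congr_fderiv ?_
    ext x
    simp
  have hinv : HasFDerivAt (fun u : E => ‖u‖⁻¹) (-innerSL ℝ v) v := by
    have h := (hasDerivAt_inv (x := ‖v‖) (by simp [hv])).comp_hasFDerivAt v hnorm
    refine h.congr_fderiv ?_
    ext x
    simp [hv]
  refine (hinv.smul (hasFDerivAt_id v)).congr_fderiv ?_
  ext x
  simp [hv, sub_eq_add_neg]

theorem norm_inv_norm_smul {u : E} (hu : u ≠ 0) : ‖‖u‖⁻¹ • u‖ = 1 := by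
  simp [norm_smul, hu]

theorem fderiv_comp_inv_norm_smul {f : E → ℝ} {w : E} (hf : DifferentiableAt ℝ f w)
    (hw : ‖w‖ = 1) (e : E) :
    fderiv ℝ (fun u : E => f (‖u‖⁻¹ • u)) w e = fderiv ℝ f w (e - ⟪w, e⟫ • w) := by
  have hr : ‖w‖⁻¹ • w = w := by simp [hw]
  have hf' : HasFDerivAt f (fderiv ℝ f w) (‖w‖⁻¹ • w) := by
    rw [hr]
    exact hf.hasFDerivAt
  have h : HasFDerivAt (fun u : E => f (‖u‖⁻¹ • u)) _ w :=
    hf'.comp (f := fun u : E => ‖u‖⁻¹ • u) w (hasFDerivAt_inv_norm_smul hw)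
  rw [h.fderiv]
  simp

/-- The iterated directional derivative of the `0`-homogeneous extension, at a unit vector. -/
theorem fderiv_fderiv_comp_inv_norm_smul {f : E → ℝ} (hf : ContDiff ℝ 2 f) {v : E}
    (hv : ‖v‖ = 1) (e : E) :
    fderiv ℝ (fun u : E => fderiv ℝ (fun w : E => f (‖w‖⁻¹ • w)) (‖u‖⁻¹ • u) e) v e
      = fderiv ℝ (fderiv ℝ f) v (e - ⟪v, e⟫ • v) (e - ⟪v, e⟫ • v)
        - fderiv ℝ f v (⟪e - ⟪v, e⟫ • v, e⟫ • v + ⟪v, e⟫ • (e - ⟪v, e⟫ • v)) := by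
  have hv0 : v ≠ 0 := by
    rintro rfl
    simp at hv
  have hr : ‖v‖⁻¹ • v = v := by simp [hv]
  have heq : (fun u : E => fderiv ℝ (fun w : E => f (‖w‖⁻¹ • w)) (‖u‖⁻¹ • u) e) =ᶠ[nhds v]
      (fun w : E => fderiv ℝ f w (e - ⟪w, e⟫ • w)) ∘ fun u : E => ‖u‖⁻¹ • u := by
    filter_upwards [isOpen_ne.mem_nhds hv0] with u hu
    exact fderiv_comp_inv_norm_smul (hf.differentiable (by norm_num) _) (norm_inv_norm_smul hu) e
  have hD : HasFDerivAt (fderiv ℝ f) (fderiv ℝ (fderiv ℝ f) v) v :=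
    ((hf.fderiv_right (m := 1) (by norm_num)).differentiable (by norm_num) v).hasFDerivAt
  have hinner := (hasFDerivAt_id v).inner ℝ (hasFDerivAt_const e v)
  have hT := (hinner.smul (hasFDerivAt_id v)).const_sub e
  have hF := hD.clm_apply hT
  have h := HasFDerivAt.comp v (hr.symm ▸ hF) (hasFDerivAt_inv_norm_smul hv)
  rw [heq.fderiv_eq]
  refine (congrArg (· e) h.fderiv).trans ?_
  simp [hr, inner_sub_left, inner_smul_left]
  ring

end Normalize

/-- Second-order chain rule for the 0-homogeneous extension (proof of Lemma 2.2): with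
`r(u) = u/|u|`, `g = f ∘ r`, `h_i = (∂_i g) ∘ r`, for `|v| = 1` one has
`∂_i h_i(v) = ∂²_{ii}f(v) - 2 Σ_j ∂²_{ij}f(v) v_j v_i - ⟨v,∇f(v)⟩ + 2 v_i² ⟨v,∇f(v)⟩
  - v_i ∂_i f(v) + v_i² ⟨∇²f(v)v, v⟩`. -/
theorem stmt_10 (d : ℕ) (hd : 2 ≤ d)
    (f : EuclideanSpace ℝ (Fin d) → ℝ) (hf : ContDiff ℝ 2 f)
    (i : Fin d) (v : EuclideanSpace ℝ (Fin d)) (hv : ‖v‖ = 1) :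
    fderiv ℝ (fun u : EuclideanSpace ℝ (Fin d) =>
        fderiv ℝ (fun w : EuclideanSpace ℝ (Fin d) => f (‖w‖⁻¹ • w)) (‖u‖⁻¹ • u)
          (EuclideanSpace.single i 1)) v (EuclideanSpace.single i 1)
      = fderiv ℝ (fun w => fderiv ℝ f w (EuclideanSpace.single i 1)) v
            (EuclideanSpace.single i 1)
        - 2 * ∑ j, fderiv ℝ (fun w => fderiv ℝ f w (EuclideanSpace.single j 1)) v
            (EuclideanSpace.single i 1) * v j * v i
        - fderiv ℝ f v v
        + 2 * (v i) ^ 2 * fderiv ℝ f v v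
        - v i * fderiv ℝ f v (EuclideanSpace.single i 1)
        + (v i) ^ 2 * fderiv ℝ (fun w => fderiv ℝ f w v) v v := by
  have hD : DifferentiableAt ℝ (fderiv ℝ f) v :=
    (hf.fderiv_right (m := 1) (by norm_num)).differentiable (by norm_num) v
  have hsecond (a b : EuclideanSpace ℝ (Fin d)) :
      fderiv ℝ (fun w => fderiv ℝ f w a) v b = fderiv ℝ (fderiv ℝ f) v b a := by
    rw [fderiv_clm_apply hD (differentiableAt_const a)]
    simp
  have hsymm (a b : EuclideanSpace ℝ (Fin d)) :
      fderiv ℝ (fderiv ℝ f) v a b = fderiv ℝ (fderiv ℝ f) v b a :=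
    (hf.contDiffAt.isSymmSndFDerivAt (by simp)).eq a b
  have hsum : ∑ j, fderiv ℝ (fderiv ℝ f) v (EuclideanSpace.single i 1)
      (EuclideanSpace.single j 1) * v j * v i
      = fderiv ℝ (fderiv ℝ f) v (EuclideanSpace.single i 1) v * v i := by
    have hv_sum : v = ∑ j, v j • EuclideanSpace.single j (1 : ℝ) := by
      simpa using ((EuclideanSpace.basisFun (Fin d) ℝ).sum_repr v).symm
    conv_rhs =>
      enter [1]
      arg 2
      rw [hv_sum]
    rw [map_sum, Finset.sum_mul]
    simp [mul_comm]
  have hinner : ⟪v, EuclideanSpace.single i (1 : ℝ)⟫ = v i := by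
    simp [EuclideanSpace.inner_single_right]
  simp only [hsecond]
  rw [fderiv_fderiv_comp_inv_norm_smul hf hv, hsum]
  simp only [inner_sub_left, inner_smul_left, hinner, map_sub, map_add, map_smul,
    sub_apply, smul_apply, smul_eq_mul,
    hsymm v (EuclideanSpace.single i 1)]
  simp
  ring
end
end

section
/- Let 𝓔 : ℝ^d → ℝ be twice continuously differentiable with |∇𝓔(v)| ≤ c₁ and |∂²_{ij}𝓔(v)| ≤ c₂ for all v ∈ 𝕊^{d−1} and all indices i, j, let α > 0, and set ω(v) = exp(−α𝓔(v)). Then for every v ∈ 𝕊^{d−1} and every G ∈ ℝ^d, Σ_{i=1}^d G_i² [ ∂²_{ii}ω(v) − 2 Σ_{j=1}^d ∂²_{ij}ω(v) v_j v_i − ⟨v, ∇ω(v)⟩ + 2 v_i² ⟨v, ∇ω(v)⟩ − v_i ∂_i ω(v) + v_i² ⟨∇²ω(v) v, v⟩ ] ≥ −( (1 + 2d + d²)(α² c₁² + α c₂) + 4 α c₁ ) exp(−α𝓔(v)) |G|². -/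
open MeasureTheory Real RealInnerProductSpace

noncomputable section

/-- A second directional derivative is the second Fréchet derivative evaluated twice. -/
theorem fderiv_fderiv_apply_const {E : Type*} [NormedAddCommGroup E] [NormedSpace ℝ E]
    {f : E → ℝ} (hf : ContDiff ℝ 2 f) (v x y : E) :
    fderiv ℝ (fun w => fderiv ℝ f w y) v x = fderiv ℝ (fderiv ℝ f) v x y := by
  have hd : DifferentiableAt ℝ (fderiv ℝ f) v :=
    (hf.fderiv_right (m := 1) (by norm_num)).differentiable (by norm_num) v
  rw [fderiv_clm_apply hd (differentiableAt_const y)]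
  simp

theorem fderiv_exp_neg_mul_apply {E : Type*} [NormedAddCommGroup E] [NormedSpace ℝ E]
    {f : E → ℝ} {w : E} (hf : DifferentiableAt ℝ f w) (α : ℝ) (y : E) :
    fderiv ℝ (fun u => Real.exp (-α * f u)) w y
      = Real.exp (-α * f w) * (-α * fderiv ℝ f w y) := by
  have h := (hf.hasFDerivAt.const_mul (-α)).exp
  rw [h.fderiv]
  simp

theorem fderiv_fderiv_exp_neg_mul_apply {E : Type*} [NormedAddCommGroup E] [NormedSpace ℝ E]
    {f : E → ℝ} (hf : ContDiff ℝ 2 f) (α : ℝ) (v x y : E) :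
    fderiv ℝ (fun w => fderiv ℝ (fun u => Real.exp (-α * f u)) w y) v x
      = Real.exp (-α * f v) * (α ^ 2 * (fderiv ℝ f v x * fderiv ℝ f v y)
          - α * fderiv ℝ (fun w => fderiv ℝ f w y) v x) := by
  have hd : Differentiable ℝ f := hf.differentiable (by norm_num)
  have hd' : DifferentiableAt ℝ (fun w => fderiv ℝ f w y) v :=
    ((hf.fderiv_right (m := 1) (by norm_num)).differentiable (by norm_num) v).clm_apply
      (differentiableAt_const y)
  simp only [fun w => fderiv_exp_neg_mul_apply (hd w) α y]
  have h := ((hd v).hasFDerivAt.const_mul (-α)).exp.mul (hd'.hasFDerivAt.const_mul (-α))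
  refine (congrArg (fun L : E →L[ℝ] ℝ => L x) h.fderiv).trans ?_
  simp
  ring

theorem norm_fderiv_eq_norm_gradient {E : Type*} [NormedAddCommGroup E] [InnerProductSpace ℝ E]
    [CompleteSpace E] (f : E → ℝ) (v : E) : ‖fderiv ℝ f v‖ = ‖gradient f v‖ := by
  simp [gradient]

theorem EuclideanSpace.sum_smul_single {d : ℕ} (v : EuclideanSpace ℝ (Fin d)) :
    ∑ j, v j • EuclideanSpace.single j (1 : ℝ) = v := by
  ext k
  simp [Pi.single_apply]

/-- A bilinear form with entries bounded by `K` is bounded by `d ^ 2 * K` on the unit cube. -/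
theorem abs_bilin_le_of_entries {d : ℕ}
    (B : EuclideanSpace ℝ (Fin d) →L[ℝ] EuclideanSpace ℝ (Fin d) →L[ℝ] ℝ) {K : ℝ}
    (hB : ∀ i j, |B (EuclideanSpace.single i 1) (EuclideanSpace.single j 1)| ≤ K)
    {v : EuclideanSpace ℝ (Fin d)} (hv : ∀ i, |v i| ≤ 1) :
    |B v v| ≤ (d : ℝ) ^ 2 * K := by
  have hexp : B v v = ∑ i, ∑ j,
      v i * (v j * B (EuclideanSpace.single i 1) (EuclideanSpace.single j 1)) := by
    conv_lhs => rw [← EuclideanSpace.sum_smul_single v]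
    simp only [map_sum, map_smul, sum_apply, smul_apply,
      smul_eq_mul, Finset.mul_sum]
    rw [Finset.sum_comm]
    refine Finset.sum_congr rfl fun i _ => Finset.sum_congr rfl fun j _ => ?_
    ring
  calc |B v v| ≤ ∑ _i : Fin d, ∑ _j : Fin d, K := by
        rw [hexp]
        refine (Finset.abs_sum_le_sum_abs _ _).trans (Finset.sum_le_sum fun i _ => ?_)
        refine (Finset.abs_sum_le_sum_abs _ _).trans (Finset.sum_le_sum fun j _ => ?_)
        rw [abs_mul, abs_mul]
        refine (mul_le_of_le_one_left (by positivity) (hv i)).trans ?_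
        exact (mul_le_of_le_one_left (abs_nonneg _) (hv j)).trans (hB i j)
    _ = (d : ℝ) ^ 2 * K := by simp; ring

/-- Pointwise lower bound on term I in the proof of Lemma 2.2, with `ω = exp(-α𝓔)`:
`Σ_i G_i² ∂²_{v_i^𝕊} ω(v) ≥ -((1+2d+d²)(α²c₁² + αc₂) + 4αc₁) e^{-α𝓔(v)} |G|²`,
where `∂²_{v_i^𝕊} ω(v)` is expressed in Euclidean derivatives at `|v| = 1`. -/
theorem stmt_15 (d : ℕ) (hd : 2 ≤ d)
    (𝓔 : EuclideanSpace ℝ (Fin d) → ℝ) (h𝓔 : ContDiff ℝ 2 𝓔)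
    (c₁ c₂ α : ℝ) (hα : 0 < α)
    (hgrad : ∀ v ∈ sph d, ‖gradient 𝓔 v‖ ≤ c₁)
    (hhess : ∀ v ∈ sph d, ∀ i j : Fin d,
      |fderiv ℝ (fun w => fderiv ℝ 𝓔 w (EuclideanSpace.single j 1)) v
        (EuclideanSpace.single i 1)| ≤ c₂)
    (v : EuclideanSpace ℝ (Fin d)) (hv : v ∈ sph d) (G : EuclideanSpace ℝ (Fin d)) :
    (∑ i, (G i) ^ 2 *
        (fderiv ℝ (fun w => fderiv ℝ (fun u => Real.exp (-α * 𝓔 u)) w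
              (EuclideanSpace.single i 1)) v (EuclideanSpace.single i 1)
          - 2 * ∑ j, fderiv ℝ (fun w => fderiv ℝ (fun u => Real.exp (-α * 𝓔 u)) w
              (EuclideanSpace.single j 1)) v (EuclideanSpace.single i 1) * v j * v i
          - fderiv ℝ (fun u => Real.exp (-α * 𝓔 u)) v v
          + 2 * (v i) ^ 2 * fderiv ℝ (fun u => Real.exp (-α * 𝓔 u)) v v
          - v i * fderiv ℝ (fun u => Real.exp (-α * 𝓔 u)) v (EuclideanSpace.single i 1)
          + (v i) ^ 2 * fderiv ℝ (fun w => fderiv ℝ (fun u => Real.exp (-α * 𝓔 u)) w v) v v))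
      ≥ -((1 + 2 * (d : ℝ) + (d : ℝ) ^ 2) * (α ^ 2 * c₁ ^ 2 + α * c₂) + 4 * α * c₁)
          * Real.exp (-α * 𝓔 v) * ‖G‖ ^ 2 := by
  have hd : Differentiable ℝ 𝓔 := h𝓔.differentiable (by norm_num)
  set ω : EuclideanSpace ℝ (Fin d) → ℝ := fun u => Real.exp (-α * 𝓔 u) with hω
  have hω2 : ContDiff ℝ 2 ω := (contDiff_const.mul h𝓔).exp
  set e := Real.exp (-α * 𝓔 v) with he
  have he0 : 0 < e := Real.exp_pos _
  have hnorm : ‖v‖ = 1 := by simpa [sph] using hv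
  have hvi : ∀ i, |v i| ≤ 1 := fun i => by
    simpa [hnorm] using PiLp.norm_apply_le v i
  have hD : ∀ y : EuclideanSpace ℝ (Fin d), ‖y‖ = 1 → |fderiv ℝ 𝓔 v y| ≤ c₁ := fun y hy => by
    have h := (fderiv ℝ 𝓔 v).le_opNorm y
    rw [hy, mul_one, norm_fderiv_eq_norm_gradient, Real.norm_eq_abs] at h
    exact h.trans (hgrad v hv)
  have hc₁ : 0 ≤ c₁ := (norm_nonneg _).trans (hgrad v hv)
  have hs : ∀ i : Fin d, ‖(EuclideanSpace.single i 1 : EuclideanSpace ℝ (Fin d))‖ = 1 := by simp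
  have hDω : ∀ y : EuclideanSpace ℝ (Fin d), ‖y‖ = 1 → |fderiv ℝ ω v y| ≤ α * c₁ * e :=
    fun y hy => by
      rw [hω, fderiv_exp_neg_mul_apply (hd v), abs_mul, abs_mul, abs_neg, abs_of_pos hα,
        abs_of_pos he0, mul_comm]
      gcongr
      exact hD y hy
  set K := (α ^ 2 * c₁ ^ 2 + α * c₂) * e with hK
  have hH : ∀ i j : Fin d, |fderiv ℝ (fun w => fderiv ℝ ω w (EuclideanSpace.single j 1)) v
      (EuclideanSpace.single i 1)| ≤ K := fun i j => by
    rw [hω, fderiv_fderiv_exp_neg_mul_apply h𝓔, abs_mul, abs_of_pos he0, hK, mul_comm]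
    gcongr
    refine (abs_sub _ _).trans ?_
    rw [abs_mul, abs_mul, abs_mul, abs_of_pos hα, abs_of_pos (pow_pos hα 2), sq c₁]
    gcongr
    · exact hD _ (hs i)
    · exact hD _ (hs j)
    · exact hhess v hv i j
  have hvv : |fderiv ℝ (fun w => fderiv ℝ ω w v) v v| ≤ (d : ℝ) ^ 2 * K := by
    rw [fderiv_fderiv_apply_const hω2]
    refine abs_bilin_le_of_entries _ (fun i j => ?_) hvi
    rw [← fderiv_fderiv_apply_const hω2]
    exact hH i j
  rw [ge_iff_le, EuclideanSpace.real_norm_sq_eq, Finset.mul_sum]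
  refine Finset.sum_le_sum fun i _ => ?_
  rw [mul_comm]
  refine mul_le_mul_of_nonneg_left ?_ (sq_nonneg _)
  have hrow : |∑ j, fderiv ℝ (fun w => fderiv ℝ ω w (EuclideanSpace.single j 1)) v
      (EuclideanSpace.single i 1) * v j * v i| ≤ d * K := by
    calc _ ≤ ∑ _j : Fin d, K := by
          refine (Finset.abs_sum_le_sum_abs _ _).trans (Finset.sum_le_sum fun j _ => ?_)
          rw [abs_mul, abs_mul]
          refine (mul_le_of_le_one_right (by positivity) (hvi i)).trans ?_
          exact (mul_le_of_le_one_right (abs_nonneg _) (hvi j)).trans (hH i j)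
      _ = d * K := by simp
  have hv2 : (v i) ^ 2 ≤ 1 := (sq_le_one_iff_abs_le_one _).2 (hvi i)
  have hlast : |(v i) ^ 2 * fderiv ℝ (fun w => fderiv ℝ ω w v) v v| ≤ (d : ℝ) ^ 2 * K := by
    rw [abs_mul, abs_of_nonneg (sq_nonneg _)]
    exact (mul_le_of_le_one_left (abs_nonneg _) hv2).trans hvv
  have hradial : |(2 * (v i) ^ 2 - 1) * fderiv ℝ ω v v| ≤ α * c₁ * e := by
    rw [abs_mul]
    refine (mul_le_of_le_one_left (abs_nonneg _) ?_).trans (hDω v hnorm)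
    exact abs_le.2 ⟨by linarith [sq_nonneg (v i)], by linarith⟩
  have hpartial : |v i * fderiv ℝ ω v (EuclideanSpace.single i 1)| ≤ α * c₁ * e := by
    rw [abs_mul]
    exact (mul_le_of_le_one_left (abs_nonneg _) (hvi i)).trans (hDω _ (hs i))
  have hpos : 0 ≤ α * c₁ * e := by positivity
  have htotal : -((1 + 2 * (d : ℝ) + (d : ℝ) ^ 2) * (α ^ 2 * c₁ ^ 2 + α * c₂) + 4 * α * c₁) * e
      = -(K + 2 * (d * K) + (d : ℝ) ^ 2 * K + 4 * (α * c₁ * e)) := by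
    rw [hK]; ring
  rw [htotal]
  linarith [(abs_le.1 (hH i i)).1, (abs_le.1 hrow).2, (abs_le.1 hlast).1,
    (abs_le.1 hradial).1, (abs_le.1 hpartial).2]
end
end
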